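/- arXiv:2003.14233 — 3 statements merged into one kernel-verified Lean document; each statement's English description precedes it below -/
import Mathlib

section
/- For every k ≥ 6, the family of P_k-free graphs is not (Γ,b)-bounded: for every function f : ℕ → ℕ there exists a finite simple graph G containing no induced subgraph isomorphic to P_k such that Γ(G) > f(b(G)). -/
open SimpleGraph

/-- The degree of a vertex `v` in a simple graph `G`. -/
noncomputable def vdeg {V : Type*} (G : SimpleGraph V) (v : V) : ℕ :=
  Nat.card {w // G.Adj v w}

/-- A Grundy coloring of `G` with `k` colors: a proper coloring whose `k` color classes are
all nonempty (surjectivity) and such that every vertex of a class has a neighbor in every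
smaller-indexed class. -/
def IsGrundyColoring {V : Type*} (G : SimpleGraph V) {k : ℕ} (C : V → Fin k) : Prop :=
  (∀ v w, G.Adj v w → C v ≠ C w) ∧
  Function.Surjective C ∧
  (∀ v : V, ∀ i : Fin k, i < C v → ∃ w, G.Adj v w ∧ C w = i)

/-- The Grundy number of `G`: the largest `k` admitting a Grundy coloring with `k` colors. -/
noncomputable def grundyNum {V : Type*} (G : SimpleGraph V) : ℕ :=
  sSup {k | ∃ C : V → Fin k, IsGrundyColoring G C}

/-- A b-coloring of `G` with `k` colors: a proper coloring such that every color class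
contains a vertex having a neighbor in each of the other classes (hence all classes are
nonempty). -/
def IsBColoring {V : Type*} (G : SimpleGraph V) {k : ℕ} (C : V → Fin k) : Prop :=
  (∀ v w, G.Adj v w → C v ≠ C w) ∧
  (∀ i : Fin k, ∃ v, C v = i ∧ ∀ j : Fin k, j ≠ i → ∃ w, G.Adj v w ∧ C w = j)

/-- The b-chromatic number of `G`: the largest `k` admitting a b-coloring with `k` colors. -/
noncomputable def bChrom {V : Type*} (G : SimpleGraph V) : ℕ :=
  sSup {k | ∃ C : V → Fin k, IsBColoring G C}

/-- The complete bipartite graph between the even and the odd elements of `Fin n`, without the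
edges `{2i, 2i + 1}` for `i ≥ 1`. -/
def bipartiteMinusMatching (n : ℕ) : SimpleGraph (Fin n) where
  Adj v w := v.val % 2 ≠ w.val % 2 ∧ (v.val / 2 ≠ w.val / 2 ∨ v.val / 2 = 0)
  symm := ⟨fun v w h => by omega⟩
  loopless := ⟨fun v h => h.1 rfl⟩

theorem bipartiteMinusMatching_adj {n : ℕ} {v w : Fin n} :
    (bipartiteMinusMatching n).Adj v w ↔
      v.val % 2 ≠ w.val % 2 ∧ (v.val / 2 ≠ w.val / 2 ∨ v.val / 2 = 0) :=
  Iff.rfl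

theorem isEmpty_pathGraph_embedding_bipartiteMinusMatching {k : ℕ} (hk : 6 ≤ k) (n : ℕ) :
    IsEmpty (SimpleGraph.pathGraph k ↪g bipartiteMinusMatching n) := by
  refine ⟨fun φ => ?_⟩
  have adj (i j : ℕ) (hi : i < k) (hj : j < k) :
      (bipartiteMinusMatching n).Adj (φ ⟨i, hi⟩) (φ ⟨j, hj⟩) ↔ i + 1 = j ∨ j + 1 = i := by
    rw [φ.map_adj_iff, SimpleGraph.pathGraph_adj]
  have ne : (φ ⟨3, by omega⟩).val ≠ (φ ⟨5, by omega⟩).val := fun h => by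
    simpa using φ.injective (Fin.ext h)
  have h01 := (adj 0 1 (by omega) (by omega)).2 (by omega)
  have h12 := (adj 1 2 (by omega) (by omega)).2 (by omega)
  have h23 := (adj 2 3 (by omega) (by omega)).2 (by omega)
  have h34 := (adj 3 4 (by omega) (by omega)).2 (by omega)
  have h45 := (adj 4 5 (by omega) (by omega)).2 (by omega)
  have h03 := mt (adj 0 3 (by omega) (by omega)).1 (by omega)
  have h05 := mt (adj 0 5 (by omega) (by omega)).1 (by omega)
  rw [bipartiteMinusMatching_adj] at h01 h12 h23 h34 h45 h03 h05
  replace h01 := h01.1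
  replace h12 := h12.1
  replace h23 := h23.1
  replace h34 := h34.1
  replace h45 := h45.1
  have parity13 : (φ ⟨1, by omega⟩).val % 2 = (φ ⟨3, by omega⟩).val % 2 := by clear h03 h05; omega
  have parity35 : (φ ⟨3, by omega⟩).val % 2 = (φ ⟨5, by omega⟩).val % 2 := by clear h03 h05; omega
  clear h12 h23 h34 h45
  have half03 : (φ ⟨0, by omega⟩).val / 2 = (φ ⟨3, by omega⟩).val / 2 := by clear h05; omega
  have half05 : (φ ⟨0, by omega⟩).val / 2 = (φ ⟨5, by omega⟩).val / 2 := by clear h03; omega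
  clear h03 h05
  omega

theorem IsBColoring.le_two_of_bipartiteMinusMatching {n k : ℕ} (hn : 2 ≤ n) {C : Fin n → Fin k}
    (hC : IsBColoring (bipartiteMinusMatching n) C) : k ≤ 2 := by
  obtain ⟨proper, hb⟩ := hC
  by_contra! hk
  obtain ⟨c, hc⟩ : ∃ c, c ∉ ({C ⟨0, by omega⟩, C ⟨1, by omega⟩} : Finset (Fin k)) := by
    by_contra! h
    have h_card := Finset.card_le_card (fun c _ => h c : Finset.univ ⊆ _)
    rw [Finset.card_univ, Fintype.card_fin] at h_card
    exact absurd (h_card.trans Finset.card_le_two) (by omega)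
  simp only [Finset.mem_insert, Finset.mem_singleton, not_or] at hc
  obtain ⟨v, rfl, hv⟩ := hb c
  rcases Nat.mod_two_eq_zero_or_one v.val with h | h
  · obtain ⟨w, hvw, hw⟩ := hv _ (Ne.symm hc.1)
    refine proper ⟨0, by omega⟩ w ?_ hw.symm
    rw [bipartiteMinusMatching_adj] at hvw ⊢
    dsimp only
    omega
  · obtain ⟨w, hvw, hw⟩ := hv _ (Ne.symm hc.2)
    refine proper ⟨1, by omega⟩ w ?_ hw.symm
    rw [bipartiteMinusMatching_adj] at hvw ⊢
    dsimp only
    omega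

theorem bChrom_bipartiteMinusMatching_le_two {n : ℕ} (hn : 2 ≤ n) :
    bChrom (bipartiteMinusMatching n) ≤ 2 :=
  csSup_le' fun _ ⟨_, hC⟩ => hC.le_two_of_bipartiteMinusMatching hn

theorem IsGrundyColoring.le_grundyNum {V : Type*} [Finite V] {G : SimpleGraph V} {k : ℕ}
    {C : V → Fin k} (hC : IsGrundyColoring G C) : k ≤ grundyNum G := by
  refine le_csSup ⟨Nat.card V, ?_⟩ ⟨C, hC⟩
  rintro l ⟨D, hD⟩
  simpa using Nat.card_le_card_of_surjective D hD.2.1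

theorem le_grundyNum_bipartiteMinusMatching (m : ℕ) :
    m + 2 ≤ grundyNum (bipartiteMinusMatching (2 * (m + 1))) := by
  let C (v : Fin (2 * (m + 1))) : Fin (m + 2) :=
    ⟨if v.val < 2 then m + v.val else v.val / 2 - 1, by split <;> omega⟩
  have hC (v) : (C v).val = if v.val < 2 then m + v.val else v.val / 2 - 1 := rfl
  refine IsGrundyColoring.le_grundyNum (C := C) ⟨fun v w h => ?_, fun c => ?_, fun v i hi => ?_⟩
  · rw [bipartiteMinusMatching_adj] at h
    rw [ne_eq, Fin.ext_iff, hC, hC]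
    split <;> split <;> omega
  · by_cases hc : c.val < m
    · exact ⟨⟨2 * (c.val + 1), by omega⟩, by
        rw [Fin.ext_iff, hC]; dsimp only; split <;> omega⟩
    · exact ⟨⟨c.val - m, by omega⟩, by
        rw [Fin.ext_iff, hC]; dsimp only; split <;> omega⟩
  · rw [Fin.lt_def, hC] at hi
    simp only [bipartiteMinusMatching_adj, Fin.ext_iff, hC]
    by_cases him : i.val < m
    · refine ⟨⟨2 * (i.val + 1) + (1 - v.val % 2), by omega⟩, ?_, ?_⟩
      · dsimp only
        split at hi <;> omega
      · dsimp only
        split <;> omega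
    · refine ⟨⟨0, by omega⟩, ?_, ?_⟩
      · dsimp only
        split at hi <;> omega
      · dsimp only
        split at hi <;> split <;> omega

/-- For every `k ≥ 6` the family of `P_k`-free graphs is not `(Γ, b)`-bounded: for every
function `f : ℕ → ℕ` there is a finite simple graph `G` with no induced `P_k` such that
`Γ(G) > f(b(G))`. -/
theorem stmt7 (k : ℕ) (hk : 6 ≤ k) (f : ℕ → ℕ) :
    ∃ (n : ℕ) (G : SimpleGraph (Fin n)),
      IsEmpty (SimpleGraph.pathGraph k ↪g G) ∧ f (bChrom G) < grundyNum G := by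
  let m := f 0 + f 1 + f 2
  refine ⟨2 * (m + 1), bipartiteMinusMatching _,
    isEmpty_pathGraph_embedding_bipartiteMinusMatching hk _, ?_⟩
  have hb := bChrom_bipartiteMinusMatching_le_two (n := 2 * (m + 1)) (by omega)
  have hg := le_grundyNum_bipartiteMinusMatching m
  have hf : ∀ b ≤ 2, f b ≤ m := by
    intro b hb
    interval_cases b <;> omega
  exact (hf _ hb).trans_lt (by omega)
end

section
/- The family of P_5-free graphs is (Γ,b)-bounded: there exists a function f : ℕ → ℕ such that every finite simple graph G containing no induced subgraph isomorphic to P_5 satisfies Γ(G) ≤ f(b(G)). -/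
open SimpleGraph

/-! ### Ramsey-type lemmas for sets of levels -/

theorem exists_subset_const {α : Type} (r n : ℕ) (J : Finset ℕ) (f : ℕ → α) (S : Finset α)
    (hS : S.card ≤ r) (hf : ∀ j ∈ J, f j ∈ S) (hJ : r * n < J.card) :
    ∃ J' ⊆ J, n ≤ J'.card ∧ ∃ a ∈ S, ∀ j ∈ J', f j = a := by
  classical
  have hJne : J.Nonempty := Finset.card_pos.mp (by omega)
  obtain ⟨j, hj⟩ := hJne
  have hle : S.card * n ≤ J.card := (Nat.mul_le_mul_right n hS).trans hJ.le
  obtain ⟨a, ha, hcard⟩ :=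
    Finset.exists_le_card_fiber_of_mul_le_card_of_maps_to hf ⟨f j, hf j hj⟩ hle
  exact ⟨J.filter (fun x => f x = a), Finset.filter_subset _ _, hcard, a, ha,
    fun j hj => (Finset.mem_filter.mp hj).2⟩

theorem exists_subset_pair_color_eq_min (r n : ℕ) :
    ∃ F, ∀ (α : Type) (J : Finset ℕ) (S : Finset α) (col : ℕ → ℕ → α), S.Nonempty →
      S.card ≤ r → (∀ i ∈ J, ∀ j ∈ J, i < j → col i j ∈ S) → F ≤ J.card →
      ∃ J' ⊆ J, n ≤ J'.card ∧ ∃ g : ℕ → α, (∀ i ∈ J', g i ∈ S) ∧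
        ∀ i ∈ J', ∀ j ∈ J', i < j → col i j = g i := by
  classical
  induction n with
  | zero =>
    refine ⟨0, fun α J S col hne _ _ _ => ?_⟩
    obtain ⟨a, ha⟩ := hne
    exact ⟨∅, by simp, by simp, fun _ => a, by simp, by simp⟩
  | succ n ih =>
    obtain ⟨F, hF⟩ := ih
    refine ⟨r * F + 2, fun α J S col hne hS hcol hJ => ?_⟩
    have hJne : J.Nonempty := Finset.card_pos.mp (by omega)
    set m := J.min' hJne with hm
    have hmJ : m ∈ J := J.min'_mem hJne
    have hlt : ∀ j ∈ J.erase m, m < j := fun j hj =>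
      lt_of_le_of_ne (J.min'_le j (Finset.mem_of_mem_erase hj)) (Finset.ne_of_mem_erase hj).symm
    obtain ⟨J₁, hJ₁, hcard, a, ha, hconst⟩ := exists_subset_const r F (J.erase m) (col m) S hS
      (fun j hj => hcol m hmJ j (Finset.mem_of_mem_erase hj) (hlt j hj))
      (by rw [Finset.card_erase_of_mem hmJ]; omega)
    have hJ₁J : J₁ ⊆ J := hJ₁.trans (Finset.erase_subset _ _)
    obtain ⟨J₂, hJ₂, hcard₂, g, hgS, hg⟩ := hF α J₁ S col hne hS
      (fun i hi j hj => hcol i (hJ₁J hi) j (hJ₁J hj)) hcard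
    have hmJ₂ : m ∉ J₂ := fun h => (Finset.notMem_erase m J) (hJ₁ (hJ₂ h))
    have hne_m : ∀ i ∈ J₂, i ≠ m := fun i hi h => hmJ₂ (h ▸ hi)
    refine ⟨insert m J₂, Finset.insert_subset hmJ (hJ₂.trans hJ₁J), ?_,
      Function.update g m a, ?_, ?_⟩
    · rw [Finset.card_insert_of_notMem hmJ₂]; omega
    · intro i hi
      rcases Finset.mem_insert.mp hi with rfl | hi
      · simpa using ha
      · rw [Function.update_of_ne (hne_m i hi)]; exact hgS i hi
    · intro i hi j hj hij
      rcases Finset.mem_insert.mp hi with rfl | hi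
      · rcases Finset.mem_insert.mp hj with rfl | hj
        · omega
        · simpa using hconst j (hJ₂ hj)
      · rcases Finset.mem_insert.mp hj with rfl | hj
        · have := hlt i (hJ₁ (hJ₂ hi)); omega
        · rw [Function.update_of_ne (hne_m i hi)]; exact hg i hi j hj hij

theorem exists_subset_pair_color_const (r n : ℕ) :
    ∃ F, ∀ (α : Type) (J : Finset ℕ) (S : Finset α) (col : ℕ → ℕ → α),
      S.card ≤ r → (∀ i ∈ J, ∀ j ∈ J, i < j → col i j ∈ S) → F ≤ J.card →
      ∃ J' ⊆ J, n ≤ J'.card ∧ ∃ a ∈ S, ∀ i ∈ J', ∀ j ∈ J', i < j → col i j = a := by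
  obtain ⟨F, hF⟩ := exists_subset_pair_color_eq_min r (r * n + 1)
  refine ⟨F + 2, fun α J S col hS hcol hJ => ?_⟩
  have hne : S.Nonempty := by
    obtain ⟨i, hi, j, hj, hij⟩ := Finset.one_lt_card.mp (show 1 < J.card by omega)
    rcases lt_or_gt_of_ne hij with h | h
    · exact ⟨_, hcol i hi j hj h⟩
    · exact ⟨_, hcol j hj i hi h⟩
  obtain ⟨J₁, hJ₁, hcard, g, hgS, hg⟩ := hF α J S col hne hS hcol (by omega)
  obtain ⟨J₂, hJ₂, hcard₂, a, ha, hconst⟩ := exists_subset_const r n J₁ g S hS hgS hcard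
  exact ⟨J₂, hJ₂.trans hJ₁, hcard₂, a, ha, fun i hi j hj hij =>
    (hg i (hJ₂ hi) j (hJ₂ hj) hij).trans (hconst i hi)⟩

theorem exists_subset_pair_homogeneous (n : ℕ) :
    ∃ F, ∀ (J : Finset ℕ) (P : ℕ → ℕ → Prop), F ≤ J.card →
      ∃ J' ⊆ J, n ≤ J'.card ∧ ((∀ i ∈ J', ∀ j ∈ J', i < j → P i j) ∨
        ∀ i ∈ J', ∀ j ∈ J', i < j → ¬ P i j) := by
  obtain ⟨F, hF⟩ := exists_subset_pair_color_const 2 n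
  refine ⟨F, fun J P hJ => ?_⟩
  obtain ⟨J', hJ', hcard, a, -, ha⟩ := hF Prop J Finset.univ P (by simp)
    (fun _ _ _ _ _ => Finset.mem_univ _) hJ
  refine ⟨J', hJ', hcard, ?_⟩
  by_cases h : a
  · exact Or.inl fun i hi j hj hij => by rw [ha i hi j hj hij]; exact h
  · exact Or.inr fun i hi j hj hij => by rw [ha i hi j hj hij]; exact h

/-! ### Induced paths, walls and components -/

/-- `G` has no induced path on five vertices, and `φ` and `c` are proper colorings of `G`. -/
structure P5FreeColored {V : Type} (G : SimpleGraph V) (φ c : V → ℕ) : Prop where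
  no_p5 : ∀ v₀ v₁ v₂ v₃ v₄, G.Adj v₀ v₁ → G.Adj v₁ v₂ → G.Adj v₂ v₃ → G.Adj v₃ v₄ →
    ¬ G.Adj v₀ v₂ → ¬ G.Adj v₀ v₃ → ¬ G.Adj v₀ v₄ → ¬ G.Adj v₁ v₃ → ¬ G.Adj v₁ v₄ →
    ¬ G.Adj v₂ v₄ → False
  proper : ∀ v w, G.Adj v w → φ v ≠ φ w
  proper' : ∀ v w, G.Adj v w → c v ≠ c w

/-- Every vertex of `U` on a level in `J` has a neighbor in `U` on each lower level in `J`. -/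
def IsSupported {V : Type} (G : SimpleGraph V) (c : V → ℕ) (U : Set V) (J : Finset ℕ) : Prop :=
  ∀ x ∈ U, c x ∈ J → ∀ i ∈ J, i < c x → ∃ y ∈ U, G.Adj x y ∧ c y = i

/-- A set `U` carrying a Grundy-like structure on the levels in `J`, with nonempty top level. -/
def IsWall {V : Type} (G : SimpleGraph V) (c : V → ℕ) (U : Set V) (J : Finset ℕ) : Prop :=
  (∃ x ∈ U, c x ∈ J ∧ ∀ i ∈ J, i ≤ c x) ∧ IsSupported G c U J

/-- No set of vertices using at most `s` colors of `φ` carries a wall with `h` levels. -/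
def NoWall {V : Type} (G : SimpleGraph V) (φ c : V → ℕ) (s h : ℕ) : Prop :=
  ∀ S : Finset ℕ, S.card ≤ s → ∀ U : Set V, (∀ x ∈ U, φ x ∈ S) →
    ∀ J : Finset ℕ, h ≤ J.card → ¬ IsWall G c U J

/-- Reachability inside the set `N`. -/
def ReachableIn {V : Type} (G : SimpleGraph V) (N : Set V) : V → V → Prop :=
  Relation.ReflTransGen fun a b => G.Adj a b ∧ a ∈ N ∧ b ∈ N

/-- `a j` is adjacent to `b i` whenever `i < j` are levels in `J`. -/
def Descends {V : Type} (G : SimpleGraph V) (J : Finset ℕ) (a b : ℕ → V) : Prop :=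
  ∀ i ∈ J, ∀ j ∈ J, i < j → G.Adj (a j) (b i)

theorem IsSupported.mono {V : Type} {G : SimpleGraph V} {c : V → ℕ} {U : Set V}
    {J J' : Finset ℕ} (h : IsSupported G c U J) (hJ : J' ⊆ J) : IsSupported G c U J' :=
  fun x hx hcx i hi => h x hx (hJ hcx) i (hJ hi)

theorem Descends.mono {V : Type} {G : SimpleGraph V} {J J' : Finset ℕ} {a b : ℕ → V}
    (h : Descends G J a b) (hJ : J' ⊆ J) : Descends G J' a b :=
  fun i hi j hj => h i (hJ hi) j (hJ hj)

theorem ReachableIn.symm {V : Type} {G : SimpleGraph V} {N : Set V} {x y : V}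
    (h : ReachableIn G N x y) : ReachableIn G N y x := by
  induction h with
  | refl => exact Relation.ReflTransGen.refl
  | tail _ hbc ih => exact Relation.ReflTransGen.head ⟨hbc.1.symm, hbc.2.2, hbc.2.1⟩ ih

theorem ReachableIn.trans {V : Type} {G : SimpleGraph V} {N : Set V} {x y z : V}
    (h : ReachableIn G N x y) (h' : ReachableIn G N y z) : ReachableIn G N x z :=
  Relation.ReflTransGen.trans h h'

theorem ReachableIn.mem {V : Type} {G : SimpleGraph V} {N : Set V} {x y : V}
    (h : ReachableIn G N x y) (hx : x ∈ N) : y ∈ N := by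
  cases h with
  | refl => exact hx
  | tail _ hbc => exact hbc.2.2

theorem ReachableIn.adj {V : Type} {G : SimpleGraph V} {N : Set V} {x y z : V}
    (h : ReachableIn G N x y) (hyz : G.Adj y z) (hy : y ∈ N) (hz : z ∈ N) :
    ReachableIn G N x z :=
  Relation.ReflTransGen.tail h ⟨hyz, hy, hz⟩

/-- Along a walk from a non-neighbor of `w` to a neighbor of `w`, some edge leaves `N(w)`. -/
theorem ReachableIn.exists_mixed_edge {V : Type} {G : SimpleGraph V} {N : Set V} {w x y : V}
    (h : ReachableIn G N x y) (hx : ¬ G.Adj w x) (hy : G.Adj w y) :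
    ∃ p q, ReachableIn G N x p ∧ ReachableIn G N x q ∧ G.Adj p q ∧ G.Adj w p ∧
      ¬ G.Adj w q := by
  induction h with
  | refl => exact absurd hy hx
  | @tail b d hb hbd ih =>
    by_cases hwb : G.Adj w b
    · exact ih hwb
    · exact ⟨d, b, Relation.ReflTransGen.tail hb hbd, hb, hbd.1.symm, hy, hwb⟩

namespace P5FreeColored

variable {V : Type} {G : SimpleGraph V} {φ c : V → ℕ}

theorem not_adj_of_eq (H : P5FreeColored G φ c) {v w : V} (h : φ v = φ w) : ¬ G.Adj v w :=
  fun hvw => H.proper v w hvw h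

theorem not_adj_of_eq' (H : P5FreeColored G φ c) {v w : V} (h : c v = c w) : ¬ G.Adj v w :=
  fun hvw => H.proper' v w hvw h

theorem chain (H : P5FreeColored G φ c) {v : V} {J : Finset ℕ} (hJ : J.Nonempty) {y t : ℕ → V}
    (hy : ∀ j ∈ J, G.Adj v (y j)) (ht : ∀ j ∈ J, ¬ G.Adj v (t j))
    (hyt : ∀ j ∈ J, G.Adj (y j) (t j)) (hyy : ∀ i ∈ J, ∀ j ∈ J, ¬ G.Adj (y i) (y j))
    (htt : ∀ i ∈ J, ∀ j ∈ J, ¬ G.Adj (t i) (t j)) :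
    (∃ i ∈ J, ∀ j ∈ J, G.Adj (y i) (t j)) ∧ ∃ i ∈ J, ∀ j ∈ J, G.Adj (y j) (t i) := by
  classical
  set D : ℕ → Finset ℕ := fun i => J.filter fun j => G.Adj (y i) (t j) with hD
  have hself : ∀ i ∈ J, i ∈ D i := fun i hi => Finset.mem_filter.mpr ⟨hi, hyt i hi⟩
  have hnest : ∀ i ∈ J, ∀ j ∈ J, D i ⊆ D j ∨ D j ⊆ D i := by
    intro i hi j hj
    by_contra hcon
    rw [not_or, Finset.not_subset, Finset.not_subset] at hcon
    obtain ⟨⟨a, ha, ha'⟩, b, hb, hb'⟩ := hcon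
    simp only [hD, Finset.mem_filter, not_and] at ha ha' hb hb'
    exact H.no_p5 (t a) (y i) v (y j) (t b) ha.2.symm (hy i hi).symm (hy j hj) hb.2
      (fun h => ht a ha.1 h.symm) (fun h => ha' ha.1 h.symm) (htt a ha.1 b hb.1) (hyy i hi j hj)
      (hb' hb.1) (ht b hb.1)
  constructor
  · obtain ⟨i, hi, hmax⟩ := Finset.exists_max_image J (fun j => (D j).card) hJ
    refine ⟨i, hi, fun j hj => ?_⟩
    have hsub : D j ⊆ D i := by
      rcases hnest i hi j hj with h | h
      · exact (Finset.eq_of_subset_of_card_le h (hmax j hj)).ge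
      · exact h
    exact (Finset.mem_filter.mp (hsub (hself j hj))).2
  · obtain ⟨i, hi, hmin⟩ := Finset.exists_min_image J (fun j => (D j).card) hJ
    refine ⟨i, hi, fun j hj => ?_⟩
    have hsub : D i ⊆ D j := by
      rcases hnest i hi j hj with h | h
      · exact h
      · exact (Finset.eq_of_subset_of_card_le h (hmin j hj)).ge
    exact (Finset.mem_filter.mp (hsub (hself i hi))).2

/-- In a component of a `P₅`-free graph every vertex is at distance at most three from `v`. -/
theorem near (H : P5FreeColored G φ c) {N : Set V} {v x : V} (hx : ReachableIn G N v x) :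
    x = v ∨ G.Adj v x ∨ (¬ G.Adj v x ∧ ∃ y ∈ N, G.Adj v y ∧ G.Adj y x) ∨
      ∃ y ∈ N, ∃ z ∈ N, G.Adj v y ∧ G.Adj y z ∧ ¬ G.Adj v z ∧ G.Adj z x ∧
        ∀ y' ∈ N, G.Adj v y' → ¬ G.Adj y' x := by
  induction hx with
  | refl => exact Or.inl rfl
  | @tail b d hb hbd ih =>
    obtain ⟨hbd, hbN, hdN⟩ := hbd
    by_cases hvd : G.Adj v d
    · exact Or.inr (Or.inl hvd)
    by_cases hex : ∃ y ∈ N, G.Adj v y ∧ G.Adj y d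
    · exact Or.inr (Or.inr (Or.inl ⟨hvd, hex⟩))
    have hfar : ∀ y' ∈ N, G.Adj v y' → ¬ G.Adj y' d := fun y' hy' h h' => hex ⟨y', hy', h, h'⟩
    rcases ih with rfl | hvb | ⟨hvb, y, hy, hvy, hyb⟩ | ⟨y, hy, z, hz, hvy, hyz, hvz, hzb, hfb⟩
    · exact absurd hbd hvd
    · exact absurd hbd (hfar b hbN hvb)
    · exact Or.inr (Or.inr (Or.inr ⟨y, hy, b, hbN, hvy, hyb, hvb, hbd, hfar⟩))
    · by_cases hzd : G.Adj z d
      · exact Or.inr (Or.inr (Or.inr ⟨y, hy, z, hz, hvy, hyz, hvz, hzd, hfar⟩))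
      · exact (H.no_p5 v y z b d hvy hyz hzb hbd hvz (fun h => hfar b hbN h hbd) hvd
          (hfb y hy hvy) (hfar y hy hvy) hzd).elim

end P5FreeColored

theorem exists_common_neighbor (r n : ℕ) :
    ∃ F, ∀ (V : Type) (G : SimpleGraph V) (φ c : V → ℕ), P5FreeColored G φ c →
      ∀ (N : Set V) (S : Finset ℕ), S.card ≤ r → (∀ x ∈ N, φ x ∈ S) →
      ∀ (J : Finset ℕ) (t : ℕ → V), (∀ j ∈ J, t j ∈ N ∧ c (t j) = j) →
      (∀ i ∈ J, ∀ j ∈ J, ReachableIn G N (t i) (t j)) → F ≤ J.card →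
      ∃ u ∈ N, ∃ J' ⊆ J, n ≤ J'.card ∧ ∀ j ∈ J', G.Adj u (t j) := by
  classical
  refine ⟨(3 * (r * (r * r))) * (n + 1) + 2, fun V G φ c H N S hS hN J t ht hconn hJ => ?_⟩
  obtain ⟨j₀, hj₀⟩ : J.Nonempty := Finset.card_pos.mp (by omega)
  set v := t j₀ with hv
  have hvN : v ∈ N := (ht j₀ hj₀).1
  have key : ∀ j ∈ J.erase j₀, ∃ k ∈ Finset.range 3, ∃ y ∈ N, ∃ z ∈ N,
      (k = 0 → G.Adj v (t j)) ∧
      (k = 1 → G.Adj v y ∧ ¬ G.Adj v (t j) ∧ G.Adj y (t j)) ∧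
      (k = 2 → G.Adj v y ∧ G.Adj y z ∧ ¬ G.Adj v z ∧ G.Adj z (t j) ∧
        ∀ y' ∈ N, G.Adj v y' → ¬ G.Adj y' (t j)) := by
    intro j hj
    obtain ⟨hjne, hjJ⟩ := Finset.mem_erase.mp hj
    rcases H.near (hconn j₀ hj₀ j hjJ) with h | h | ⟨h, y, hy, hvy, hyt⟩ |
      ⟨y, hy, z, hz, h⟩
    · exact absurd (by rw [← (ht j hjJ).2, h, (ht j₀ hj₀).2]) hjne
    · exact ⟨0, by simp, v, hvN, v, hvN, fun _ => h, by simp, by simp⟩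
    · exact ⟨1, by simp, y, hy, v, hvN, by simp, fun _ => ⟨hvy, h, hyt⟩, by simp⟩
    · exact ⟨2, by simp, y, hy, z, hz, by simp, by simp, fun _ => h⟩
  have : Nonempty V := ⟨v⟩
  choose! k hk y hy z hz h₀ h₁ h₂ using key
  obtain ⟨J', hJ', hcard, ⟨k₀, a, b, d⟩, hmem, hconst⟩ := exists_subset_const
    (3 * (r * (r * r))) (n + 1) (J.erase j₀)
    (fun j => (k j, φ (y j), φ (z j), φ (t j))) (Finset.range 3 ×ˢ S ×ˢ S ×ˢ S)
    (by
      simp only [Finset.card_product, Finset.card_range]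
      gcongr)
    (fun j hj => by
      simp only [Finset.mem_product]
      exact ⟨hk j hj, hN _ (hy j hj), hN _ (hz j hj), hN _ (ht j (Finset.mem_of_mem_erase hj)).1⟩)
    (by rw [Finset.card_erase_of_mem hj₀]; omega)
  simp only [Prod.mk.injEq] at hconst
  have hJ'J : J' ⊆ J := hJ'.trans (Finset.erase_subset _ _)
  have hne : J'.Nonempty := Finset.card_pos.mp (by omega)
  have hyy : ∀ i ∈ J', ∀ j ∈ J', ¬ G.Adj (y i) (y j) := fun i hi j hj =>
    H.not_adj_of_eq ((hconst i hi).2.1.trans (hconst j hj).2.1.symm)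
  have hzz : ∀ i ∈ J', ∀ j ∈ J', ¬ G.Adj (z i) (z j) := fun i hi j hj =>
    H.not_adj_of_eq ((hconst i hi).2.2.1.trans (hconst j hj).2.2.1.symm)
  have htt : ∀ i ∈ J', ∀ j ∈ J', ¬ G.Adj (t i) (t j) := fun i hi j hj =>
    H.not_adj_of_eq ((hconst i hi).2.2.2.trans (hconst j hj).2.2.2.symm)
  have hk₀ : k₀ = 0 ∨ k₀ = 1 ∨ k₀ = 2 := by
    have := (Finset.mem_product.mp hmem).1
    simp only [Finset.mem_range] at this
    omega
  rcases hk₀ with rfl | rfl | rfl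
  · exact ⟨v, hvN, J', hJ'J, by omega, fun j hj => h₀ j (hJ' hj) (hconst j hj).1⟩
  · have h : ∀ j ∈ J', _ := fun j hj => h₁ j (hJ' hj) (hconst j hj).1
    obtain ⟨i, hi, hadj⟩ := (H.chain hne (fun j hj => (h j hj).1) (fun j hj => (h j hj).2.1)
      (fun j hj => (h j hj).2.2) hyy htt).1
    exact ⟨y i, hy i (hJ' hi), J', hJ'J, by omega, hadj⟩
  · have h : ∀ j ∈ J', _ := fun j hj => h₂ j (hJ' hj) (hconst j hj).1
    obtain ⟨i, hi, hadj⟩ := (H.chain hne (fun j hj => (h j hj).1) (fun j hj => (h j hj).2.2.1)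
      (fun j hj => (h j hj).2.1) hyy hzz).1
    obtain ⟨l, hl, hadj'⟩ := (H.chain hne hadj
      (fun j hj => (h j hj).2.2.2.2 (y i) (hy i (hJ' hi)) (h i hi).1)
      (fun j hj => (h j hj).2.2.2.1) hzz htt).1
    exact ⟨z l, hz l (hJ' hl), J', hJ'J, by omega, hadj'⟩

/-! ### Descending sequences of levels -/

/-- The vertices of `U` adjacent to each of `q 0, …, q (r - 1)`. -/
def commonNbrs {V : Type} (G : SimpleGraph V) (U : Set V) (q : ℕ → V) (r : ℕ) : Set V :=
  {x | x ∈ U ∧ ∀ i < r, G.Adj (q i) x}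

namespace P5FreeColored

variable {V : Type} {G : SimpleGraph V} {φ c : V → ℕ}

/-- A vertex is adjacent to some, but not all, vertices of at most one component of `N`. -/
theorem adj_or_adj_of_not_reachableIn (H : P5FreeColored G φ c) {N : Set V} {w a b x y : V}
    (hab : ¬ ReachableIn G N a b) (ha : a ∈ N) (hb : b ∈ N) (hx : ReachableIn G N a x)
    (hy : ReachableIn G N b y) (hwx : G.Adj w x) (hwy : G.Adj w y) :
    G.Adj w a ∨ G.Adj w b := by
  by_contra hcon
  rw [not_or] at hcon
  obtain ⟨p, q, hp, hq, hpq, hwp, hwq⟩ := hx.exists_mixed_edge hcon.1 hwx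
  obtain ⟨p', q', hp', hq', hpq', hwp', hwq'⟩ := hy.exists_mixed_edge hcon.2 hwy
  have hsep : ∀ u u', ReachableIn G N a u → ReachableIn G N b u' → ¬ G.Adj u u' :=
    fun u u' hu hu' h => hab ((hu.adj h (hu.mem ha) (hu'.mem hb)).trans hu'.symm)
  exact H.no_p5 q p w p' q' hpq.symm hwp.symm hwp' hpq' (fun h => hwq h.symm)
    (hsep q p' hq hp') (hsep q q' hq hq') (hsep p p' hp hp') (hsep p q' hp hq') hwq'

end P5FreeColored

theorem exists_descends (s h m : ℕ) : ∀ r n : ℕ,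
    ∃ F, ∀ (V : Type) (G : SimpleGraph V) (φ c : V → ℕ), P5FreeColored G φ c →
      NoWall G φ c s h → ∀ (U : Set V) (S₀ : Finset ℕ), S₀.card ≤ s + 1 → (∀ x ∈ U, φ x ∈ S₀) →
      ∀ (q : ℕ → V) (S : Finset ℕ), S.card ≤ m → (∀ x ∈ commonNbrs G U q r, φ x ∈ S) →
      ∀ (J : Finset ℕ) (t : ℕ → V), IsSupported G c U J →
      (∀ j ∈ J, t j ∈ commonNbrs G U q r ∧ c (t j) = j) →
      (∀ i ∈ J, ∀ j ∈ J, ReachableIn G (commonNbrs G U q r) (t i) (t j)) → F ≤ J.card →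
      ∃ J' ⊆ J, n ≤ J'.card ∧ ∃ b : ℕ → V, (∀ i ∈ J', b i ∈ U ∧ c (b i) = i) ∧
        Descends G J' t b := by
  classical
  induction m with
  | zero =>
    intro r n
    refine ⟨1, fun V G φ c H hW U S₀ hS₀ hU q S hS hN J t hJU ht hconn hJ => ?_⟩
    obtain ⟨j, hj⟩ : J.Nonempty := Finset.card_pos.mp (by omega)
    have := Finset.card_pos.mpr ⟨_, hN _ (ht j hj).1⟩
    omega
  | succ m ih =>
    intro r n
    obtain ⟨F₀, hF₀⟩ := ih (r + 1) n
    obtain ⟨F₅, hF₅⟩ := exists_subset_pair_homogeneous (n + 3)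
    obtain ⟨F₄, hF₄⟩ := exists_subset_pair_color_const ((r + 1) * (s + 1)) (F₅ + 1)
    obtain ⟨F₃, hF₃⟩ := exists_subset_pair_homogeneous (F₄ + h + 1)
    obtain ⟨F₂, hF₂⟩ := exists_subset_pair_homogeneous (F₀ + F₃)
    obtain ⟨F₁, hF₁⟩ := exists_common_neighbor (m + 1) F₂
    refine ⟨F₁, fun V G φ c H hW U S₀ hS₀ hU q S hS hN J t hJU ht hconn hJ => ?_⟩
    obtain ⟨u, hu, J₁, hJ₁, hcard₁, hut⟩ := hF₁ V G φ c H _ S hS hN J t ht hconn hJ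
    have : Nonempty V := ⟨u⟩
    set q' : ℕ → V := Function.update q r u with hq'
    have hq'r : q' r = u := by simp [hq']
    have hq'lt : ∀ i < r, q' i = q i := fun i hi => by
      rw [hq', Function.update_of_ne (by omega)]
    set N' := commonNbrs G U q' (r + 1) with hN'def
    have hN'u : ∀ x ∈ N', G.Adj u x := fun x hx => hq'r ▸ hx.2 r (by omega)
    have hN'sub : ∀ x ∈ N', x ∈ commonNbrs G U q r := fun x hx =>
      ⟨hx.1, fun i hi => hq'lt i hi ▸ hx.2 i (by omega)⟩
    have htN' : ∀ j ∈ J₁, t j ∈ N' := by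
      intro j hj
      refine ⟨(ht j (hJ₁ hj)).1.1, fun i hi => ?_⟩
      rcases Nat.lt_succ_iff_lt_or_eq.mp hi with hi | rfl
      · rw [hq'lt i hi]; exact (ht j (hJ₁ hj)).1.2 i hi
      · rw [hq'r]; exact hut j hj
    have hN'φ : ∀ x ∈ N', φ x ∈ S.erase (φ u) := fun x hx =>
      Finset.mem_erase.mpr ⟨(H.proper u x (hN'u x hx)).symm, hN x (hN'sub x hx)⟩
    have hScard : (S.erase (φ u)).card ≤ m := by
      rw [Finset.card_erase_of_mem (hN u hu)]; omega
    obtain ⟨J₂, hJ₂, hcard₂, hJ₂conn⟩ :=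
      hF₂ J₁ (fun i j => ReachableIn G N' (t i) (t j)) hcard₁
    have hJ₂J : J₂ ⊆ J := hJ₂.trans hJ₁
    rcases hJ₂conn with hJ₂conn | hJ₂conn
    · obtain ⟨J', hJ', hrest⟩ := hF₀ V G φ c H hW U S₀ hS₀ hU q' (S.erase (φ u)) hScard hN'φ J₂ t
        (hJU.mono hJ₂J) (fun j hj => ⟨htN' j (hJ₂ hj), (ht j (hJ₂J hj)).2⟩)
        (fun i hi j hj => by
          rcases lt_trichotomy i j with hij | rfl | hij
          · exact hJ₂conn i hi j hj hij
          · exact Relation.ReflTransGen.refl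
          · exact (hJ₂conn j hj i hi hij).symm) (by omega)
      exact ⟨J', hJ'.trans hJ₂J, hrest⟩
    obtain ⟨J₃, hJ₃, hcard₃, hex⟩ := hF₃ J₂ (fun l j => ∃ x y, ReachableIn G N' (t j) x ∧
      G.Adj x y ∧ c y = l ∧ y ∈ U ∧ y ∉ N') (by omega)
    have hJ₃J : J₃ ⊆ J := hJ₃.trans hJ₂J
    rcases hex with hex | hex
    · have hex' : ∀ l j, l ∈ J₃ → j ∈ J₃ → l < j → ∃ x y k, ReachableIn G N' (t j) x ∧
          G.Adj x y ∧ c y = l ∧ y ∈ U ∧ k < r + 1 ∧ ¬ G.Adj (q' k) y := by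
        intro l j hl hj hlj
        obtain ⟨x, y, hx, hxy, hcy, hyU, hyN⟩ := hex l hl j hj hlj
        obtain ⟨k, hk, hky⟩ : ∃ k < r + 1, ¬ G.Adj (q' k) y := by
          by_contra hcon
          push Not at hcon
          exact hyN ⟨hyU, hcon⟩
        exact ⟨x, y, k, hx, hxy, hcy, hyU, hk, hky⟩
      choose! x y k hx hxy hcy hyU hk hky using hex'
      have htN₃ : ∀ j ∈ J₃, t j ∈ N' := fun j hj => htN' j (hJ₂ (hJ₃ hj))
      have hxN : ∀ l ∈ J₃, ∀ j ∈ J₃, l < j → x l j ∈ N' := fun l hl j hj hlj =>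
        (hx l j hl hj hlj).mem (htN₃ j hj)
      obtain ⟨J₄, hJ₄, hcard₄, ⟨k₀, a⟩, hmem, hconst⟩ := hF₄ (ℕ × ℕ) J₃
        (Finset.range (r + 1) ×ˢ S₀) (fun l j => (k l j, φ (x l j)))
        (by rw [Finset.card_product, Finset.card_range]; gcongr)
        (fun l hl j hj hlj => Finset.mem_product.mpr
          ⟨Finset.mem_range.mpr (hk l j hl hj hlj), hU _ (hxN l hl j hj hlj).1⟩) (by omega)
      simp only [Prod.mk.injEq] at hconst
      have hk₀ : k₀ < r + 1 := Finset.mem_range.mp (Finset.mem_product.mp hmem).1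
      have hne₄ : J₄.Nonempty := Finset.card_pos.mp (by omega)
      set J₄' := J₄.erase (J₄.max' hne₄) with hJ₄'
      have hJ₄'sub : J₄' ⊆ J₄ := Finset.erase_subset _ _
      have hcard₄' : F₅ ≤ J₄'.card := by
        rw [hJ₄', Finset.card_erase_of_mem (J₄.max'_mem hne₄)]; omega
      have hy₀ : ∀ l ∈ J₄', ∃ y₀, y₀ ∈ U ∧ c y₀ = l ∧ ∀ j ∈ J₄, l < j → G.Adj (x l j) y₀ := by
        intro l hl
        have hl₃ : l ∈ J₃ := hJ₄ (hJ₄'sub hl)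
        have hmem' : ∀ j ∈ J₄.filter (l < ·), j ∈ J₄ ∧ l < j := fun j hj =>
          Finset.mem_filter.mp hj
        obtain ⟨i, hi, hadj⟩ := (H.chain (v := q' k₀) (J := J₄.filter (l < ·)) (y := x l) (t := y l)
          ⟨J₄.max' hne₄, Finset.mem_filter.mpr ⟨J₄.max'_mem hne₄, lt_of_le_of_ne
            (J₄.le_max' l (hJ₄'sub hl)) (Finset.ne_of_mem_erase hl)⟩⟩
          (fun j hj => (hxN l hl₃ j (hJ₄ (hmem' j hj).1) (hmem' j hj).2).2 k₀ hk₀)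
          (fun j hj => by
            rw [← (hconst l (hJ₄'sub hl) j (hmem' j hj).1 (hmem' j hj).2).1]
            exact hky l j hl₃ (hJ₄ (hmem' j hj).1) (hmem' j hj).2)
          (fun j hj => hxy l j hl₃ (hJ₄ (hmem' j hj).1) (hmem' j hj).2)
          (fun i hi j hj => H.not_adj_of_eq
            ((hconst l (hJ₄'sub hl) i (hmem' i hi).1 (hmem' i hi).2).2.trans
              (hconst l (hJ₄'sub hl) j (hmem' j hj).1 (hmem' j hj).2).2.symm))
          (fun i hi j hj => H.not_adj_of_eq'
            ((hcy l i hl₃ (hJ₄ (hmem' i hi).1) (hmem' i hi).2).trans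
              (hcy l j hl₃ (hJ₄ (hmem' j hj).1) (hmem' j hj).2).symm))).2
        refine ⟨y l i, hyU l i hl₃ (hJ₄ (hmem' i hi).1) (hmem' i hi).2,
          hcy l i hl₃ (hJ₄ (hmem' i hi).1) (hmem' i hi).2, fun j hj hlj =>
          hadj j (Finset.mem_filter.mpr ⟨hj, hlj⟩)⟩
      choose! b hbU hcb hb using hy₀
      obtain ⟨J₅, hJ₅, hcard₅, hJ₅adj⟩ := hF₅ J₄' (fun l j => G.Adj (t j) (b l)) hcard₄'
      have hJ₅J₃ : J₅ ⊆ J₃ := hJ₅.trans (hJ₄'sub.trans hJ₄)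
      refine ⟨J₅, hJ₅J₃.trans hJ₃J, by omega, b, fun i hi => ⟨hbU i (hJ₅ hi), hcb i (hJ₅ hi)⟩, ?_⟩
      rcases hJ₅adj with hJ₅adj | hJ₅adj
      · exact hJ₅adj
      · exfalso
        set e := J₅.orderEmbOfCardLe (show 3 ≤ J₅.card by omega) with he
        have heJ : ∀ i, e i ∈ J₅ := fun i => J₅.orderEmbOfCardLe_mem _ i
        have h01 : e 0 < e 1 := e.lt_iff_lt.mpr (by decide)
        have h02 : e 0 < e 2 := e.lt_iff_lt.mpr (by decide)
        have h12 : e 1 < e 2 := e.lt_iff_lt.mpr (by decide)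
        rcases H.adj_or_adj_of_not_reachableIn (w := b (e 0))
          (hJ₂conn _ (hJ₃ (hJ₅J₃ (heJ 1))) _ (hJ₃ (hJ₅J₃ (heJ 2))) h12)
          (htN₃ _ (hJ₅J₃ (heJ 1))) (htN₃ _ (hJ₅J₃ (heJ 2)))
          (hx _ _ (hJ₅J₃ (heJ 0)) (hJ₅J₃ (heJ 1)) h01)
          (hx _ _ (hJ₅J₃ (heJ 0)) (hJ₅J₃ (heJ 2)) h02)
          (hb _ (hJ₅ (heJ 0)) _ (hJ₄'sub (hJ₅ (heJ 1))) h01).symm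
          (hb _ (hJ₅ (heJ 0)) _ (hJ₄'sub (hJ₅ (heJ 2))) h02).symm with h' | h'
        · exact hJ₅adj _ (heJ 0) _ (heJ 1) h01 h'.symm
        · exact hJ₅adj _ (heJ 0) _ (heJ 2) h02 h'.symm
    · exfalso
      have hne₃ : J₃.Nonempty := Finset.card_pos.mp (by omega)
      set j := J₃.max' hne₃ with hj
      have hjJ : j ∈ J₃ := J₃.max'_mem hne₃
      have htj : t j ∈ N' := htN' j (hJ₂ (hJ₃ hjJ))
      refine hW (S₀.erase (φ u)) (by rw [Finset.card_erase_of_mem (hU u hu.1)]; omega)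
        {x | ReachableIn G N' (t j) x} (fun x hx => ?_) J₃ (by omega)
        ⟨⟨t j, Relation.ReflTransGen.refl, ?_, fun i hi => ?_⟩, fun x hx hcx i hi hix => ?_⟩
      · have hxN : x ∈ N' := ReachableIn.mem hx htj
        exact Finset.mem_erase.mpr ⟨(H.proper u x (hN'u x hxN)).symm, hU x hxN.1⟩
      · rw [(ht j (hJ₃J hjJ)).2]; exact hjJ
      · rw [(ht j (hJ₃J hjJ)).2]; exact J₃.le_max' i hi
      · have hxN : x ∈ N' := ReachableIn.mem hx htj
        obtain ⟨y, hyU, hxy, hcy⟩ := hJU x hxN.1 (hJ₃J hcx) i (hJ₃J hi) hix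
        by_cases hyN : y ∈ N'
        · exact ⟨y, ReachableIn.adj hx hxy hxN hyN, hxy, hcy⟩
        · exact (hex i hi j hjJ (hix.trans_le (J₃.le_max' _ hcx))
            ⟨x, y, hx, hxy, hcy, hyU, hyN⟩).elim

/-- Two independent sequences joined in both directions contain an induced `P₅`. -/
theorem P5FreeColored.not_descends_and_ascends {V : Type} {G : SimpleGraph V} {φ c : V → ℕ}
    (H : P5FreeColored G φ c) {J : Finset ℕ} {a b : ℕ → V} (e : Fin 6 ↪o ℕ) (he : ∀ k, e k ∈ J)
    (haa : ∀ i ∈ J, ∀ j ∈ J, ¬ G.Adj (a i) (a j)) (hbb : ∀ i ∈ J, ∀ j ∈ J, ¬ G.Adj (b i) (b j))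
    (hab : ∀ i ∈ J, ¬ G.Adj (a i) (b i)) (h : Descends G J a b) (h' : Descends G J b a) :
    False := by
  have lt : ∀ {k l : Fin 6}, k < l → e k < e l := fun h => e.lt_iff_lt.mpr h
  have h01 : e 0 < e 1 := lt (by decide)
  have h02 : e 0 < e 2 := lt (by decide)
  have h12 : e 1 < e 2 := lt (by decide)
  exact H.no_p5 (a (e 0)) (b (e 1)) (a (e 2)) (b (e 0)) (a (e 1))
    (h' _ (he 0) _ (he 1) h01).symm (h _ (he 1) _ (he 2) h12).symm (h _ (he 0) _ (he 2) h02)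
    (h _ (he 0) _ (he 1) h01).symm (haa _ (he 0) _ (he 2)) (hab _ (he 0))
    (haa _ (he 0) _ (he 1)) (hbb _ (he 1) _ (he 0)) (fun h => hab _ (he 1) h.symm)
    (haa _ (he 2) _ (he 1))

theorem descends_trans (r n : ℕ) :
    ∃ F, ∀ (V : Type) (G : SimpleGraph V) (φ c : V → ℕ), P5FreeColored G φ c →
      ∀ (U : Set V) (S : Finset ℕ), S.card ≤ r → (∀ x ∈ U, φ x ∈ S) →
      ∀ (J : Finset ℕ) (a b d : ℕ → V), (∀ j ∈ J, a j ∈ U ∧ c (a j) = j) →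
      (∀ j ∈ J, b j ∈ U ∧ c (b j) = j) → (∀ j ∈ J, d j ∈ U ∧ c (d j) = j) →
      Descends G J a b → Descends G J b d → F ≤ J.card →
      ∃ J' ⊆ J, n ≤ J'.card ∧ Descends G J' a d := by
  obtain ⟨F₄, hF₄⟩ := exists_subset_pair_homogeneous (n + 6)
  obtain ⟨F₃, hF₃⟩ := exists_subset_pair_homogeneous F₄
  obtain ⟨F₂, hF₂⟩ := exists_subset_pair_homogeneous F₃
  obtain ⟨F₁, hF₁⟩ := exists_subset_pair_homogeneous F₂
  refine ⟨r * (r * r) * F₁ + 1, fun V G φ c H U S hS hU J a b d ha hb hd hab hbd hJ => ?_⟩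
  obtain ⟨J₀, hJ₀, hcard₀, ⟨a₀, b₀, d₀⟩, -, hconst⟩ := exists_subset_const (r * (r * r)) F₁ J
    (fun j => (φ (a j), φ (b j), φ (d j))) (S ×ˢ S ×ˢ S)
    (by simp only [Finset.card_product]; gcongr)
    (fun j hj => by
      simp only [Finset.mem_product]
      exact ⟨hU _ (ha j hj).1, hU _ (hb j hj).1, hU _ (hd j hj).1⟩)
    (by omega)
  simp only [Prod.mk.injEq] at hconst
  obtain ⟨J₁, hJ₁, hcard₁, hda⟩ := hF₁ J₀ (fun i j => G.Adj (d j) (a i)) hcard₀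
  obtain ⟨J₂, hJ₂, hcard₂, hba⟩ := hF₂ J₁ (fun i j => G.Adj (b j) (a i)) hcard₁
  obtain ⟨J₃, hJ₃, hcard₃, hdb⟩ := hF₃ J₂ (fun i j => G.Adj (d j) (b i)) hcard₂
  obtain ⟨K, hK, hcard, had⟩ := hF₄ J₃ (fun i j => G.Adj (a j) (d i)) hcard₃
  have hK₂ : K ⊆ J₂ := hK.trans hJ₃
  have hK₁ : K ⊆ J₁ := hK₂.trans hJ₂
  have hK₀ : K ⊆ J₀ := hK₁.trans hJ₁
  have hKJ : K ⊆ J := hK₀.trans hJ₀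
  refine ⟨K, hKJ, by omega, ?_⟩
  rcases had with had | had
  · exact had
  exfalso
  have haa : ∀ i ∈ K, ∀ j ∈ K, ¬ G.Adj (a i) (a j) := fun i hi j hj =>
    H.not_adj_of_eq ((hconst i (hK₀ hi)).1.trans (hconst j (hK₀ hj)).1.symm)
  have hbb : ∀ i ∈ K, ∀ j ∈ K, ¬ G.Adj (b i) (b j) := fun i hi j hj =>
    H.not_adj_of_eq ((hconst i (hK₀ hi)).2.1.trans (hconst j (hK₀ hj)).2.1.symm)
  have hdd : ∀ i ∈ K, ∀ j ∈ K, ¬ G.Adj (d i) (d j) := fun i hi j hj =>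
    H.not_adj_of_eq ((hconst i (hK₀ hi)).2.2.trans (hconst j (hK₀ hj)).2.2.symm)
  have hab' : ∀ i ∈ K, ¬ G.Adj (a i) (b i) := fun i hi =>
    H.not_adj_of_eq' ((ha i (hKJ hi)).2.trans (hb i (hKJ hi)).2.symm)
  have hbd' : ∀ i ∈ K, ¬ G.Adj (b i) (d i) := fun i hi =>
    H.not_adj_of_eq' ((hb i (hKJ hi)).2.trans (hd i (hKJ hi)).2.symm)
  set e : Fin 6 ↪o ℕ := K.orderEmbOfCardLe (show 6 ≤ K.card by omega) with he
  have heK : ∀ k, e k ∈ K := fun k => K.orderEmbOfCardLe_mem _ k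
  have lt : ∀ {k l : Fin 6}, k < l → e k < e l := fun h => e.lt_iff_lt.mpr h
  have habK := hab.mono hKJ
  have hbdK := hbd.mono hKJ
  rcases hba with hba | hba
  · exact H.not_descends_and_ascends e heK haa hbb hab' habK
      (fun i hi j hj => hba i (hK₂ hi) j (hK₂ hj))
  rcases hdb with hdb | hdb
  · exact H.not_descends_and_ascends e heK hbb hdd hbd' hbdK
      (fun i hi j hj => hdb i (hK hi) j (hK hj))
  have nba : ∀ {k l : Fin 6}, k < l → ¬ G.Adj (b (e l)) (a (e k)) := fun h =>
    hba _ (hK₂ (heK _)) _ (hK₂ (heK _)) (lt h)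
  have ndb : ∀ {k l : Fin 6}, k < l → ¬ G.Adj (d (e l)) (b (e k)) := fun h =>
    hdb _ (hK (heK _)) _ (hK (heK _)) (lt h)
  have nad : ∀ {k l : Fin 6}, k < l → ¬ G.Adj (a (e l)) (d (e k)) := fun h =>
    had _ (heK _) _ (heK _) (lt h)
  have adj_ab : ∀ {k l : Fin 6}, k < l → G.Adj (a (e l)) (b (e k)) := fun h =>
    habK _ (heK _) _ (heK _) (lt h)
  have adj_bd : ∀ {k l : Fin 6}, k < l → G.Adj (b (e l)) (d (e k)) := fun h =>
    hbdK _ (heK _) _ (heK _) (lt h)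
  rcases hda with hda | hda
  · have adj_da : ∀ {k l : Fin 6}, k < l → G.Adj (d (e l)) (a (e k)) := fun h =>
      hda _ (hK₁ (heK _)) _ (hK₁ (heK _)) (lt h)
    exact H.no_p5 (a (e 5)) (b (e 3)) (d (e 2)) (a (e 1)) (d (e 4))
      (adj_ab (by decide)) (adj_bd (by decide)) (adj_da (by decide)) (adj_da (by decide)).symm
      (nad (by decide)) (haa _ (heK _) _ (heK _)) (nad (by decide)) (nba (by decide))
      (fun h => ndb (by decide) h.symm) (hdd _ (heK _) _ (heK _))
  · exact H.no_p5 (a (e 4)) (b (e 2)) (d (e 1)) (b (e 5)) (d (e 3))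
      (adj_ab (by decide)) (adj_bd (by decide)) (adj_bd (by decide)).symm (adj_bd (by decide))
      (nad (by decide)) (fun h => nba (by decide) h.symm) (nad (by decide))
      (hbb _ (heK _) _ (heK _)) (fun h => ndb (by decide) h.symm) (hdd _ (heK _) _ (heK _))

theorem descends_trans_family (r R : ℕ) : ∀ n,
    ∃ F, ∀ (V : Type) (G : SimpleGraph V) (φ c : V → ℕ), P5FreeColored G φ c →
      ∀ (U : Set V) (S : Finset ℕ), S.card ≤ r → (∀ x ∈ U, φ x ∈ S) →
      ∀ (J : Finset ℕ) (t : ℕ → ℕ → V) (b d : ℕ → V),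
      (∀ k < R, ∀ j ∈ J, t k j ∈ U ∧ c (t k j) = j) →
      (∀ j ∈ J, b j ∈ U ∧ c (b j) = j) → (∀ j ∈ J, d j ∈ U ∧ c (d j) = j) →
      (∀ k < R, Descends G J (t k) b) → Descends G J b d → F ≤ J.card →
      ∃ J' ⊆ J, n ≤ J'.card ∧ ∀ k < R, Descends G J' (t k) d := by
  induction R with
  | zero =>
    exact fun n => ⟨n, fun V G φ c _ U S _ _ J t b d _ _ _ _ _ hJ => ⟨J, subset_rfl, hJ, by simp⟩⟩
  | succ R ih =>
    intro n
    obtain ⟨F₂, hF₂⟩ := descends_trans r n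
    obtain ⟨F₁, hF₁⟩ := ih F₂
    refine ⟨F₁, fun V G φ c H U S hS hU J t b d ht hb hd htb hbd hJ => ?_⟩
    obtain ⟨J₁, hJ₁, hcard₁, h₁⟩ := hF₁ V G φ c H U S hS hU J t b d
      (fun k hk => ht k (by omega)) hb hd (fun k hk => htb k (by omega)) hbd hJ
    obtain ⟨J₂, hJ₂, hcard₂, h₂⟩ := hF₂ V G φ c H U S hS hU J₁ (t R) b d
      (fun j hj => ht R (by omega) j (hJ₁ hj)) (fun j hj => hb j (hJ₁ hj))
      (fun j hj => hd j (hJ₁ hj)) ((htb R (by omega)).mono hJ₁) (hbd.mono hJ₁) hcard₁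
    refine ⟨J₂, hJ₂.trans hJ₁, hcard₂, fun k hk => ?_⟩
    rcases Nat.lt_succ_iff_lt_or_eq.mp hk with hk | rfl
    · exact (h₁ k hk).mono hJ₂
    · exact h₂

theorem exists_descending_family (s h D : ℕ) : ∀ n,
    ∃ F, ∀ (V : Type) (G : SimpleGraph V) (φ c : V → ℕ), P5FreeColored G φ c →
      NoWall G φ c s h → ∀ (U : Set V) (S : Finset ℕ), S.card ≤ s + 1 → (∀ x ∈ U, φ x ∈ S) →
      ∀ (J : Finset ℕ) (x : V), x ∈ U → c x ∈ J → (∀ i ∈ J, i ≤ c x) → IsSupported G c U J →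
      F ≤ J.card →
      ∃ J' ⊆ J, n ≤ J'.card ∧ ∃ t : ℕ → ℕ → V,
        (∀ r ≤ D, ∀ j ∈ J', t r j ∈ U ∧ c (t r j) = j) ∧
        (∀ r ≤ D, ∀ j ∈ J', ReachableIn G U x (t r j)) ∧
        ∀ r r', r < r' → r' ≤ D → Descends G J' (t r) (t r') := by
  classical
  induction D with
  | zero =>
    intro n
    refine ⟨n + 1, fun V G φ c H hW U S hS hU J x hx hcx hmax hJU hJ => ?_⟩
    have hlt : ∀ j ∈ J.erase (c x), j < c x := fun j hj =>
      lt_of_le_of_ne (hmax j (Finset.mem_of_mem_erase hj)) (Finset.ne_of_mem_erase hj)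
    have hex : ∀ j ∈ J.erase (c x), ∃ y, y ∈ U ∧ G.Adj x y ∧ c y = j := fun j hj =>
      hJU x hx hcx j (Finset.mem_of_mem_erase hj) (hlt j hj)
    have : Nonempty V := ⟨x⟩
    choose! y hyU hxy hcy using hex
    refine ⟨J.erase (c x), Finset.erase_subset _ _, ?_, fun _ => y,
      fun _ _ j hj => ⟨hyU j hj, hcy j hj⟩, fun _ _ j hj => ?_, fun r r' _ _ => by omega⟩
    · rw [Finset.card_erase_of_mem hcx]; omega
    · exact ReachableIn.adj Relation.ReflTransGen.refl (hxy j hj) hx (hyU j hj)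
  | succ D ih =>
    intro n
    obtain ⟨F₃, hF₃⟩ := descends_trans_family (s + 1) D n
    obtain ⟨F₂, hF₂⟩ := exists_descends s h (s + 1) 0 (F₃ + 1)
    obtain ⟨F₁, hF₁⟩ := ih F₂
    refine ⟨F₁, fun V G φ c H hW U S hS hU J x hx hcx hmax hJU hJ => ?_⟩
    obtain ⟨J₁, hJ₁, hcard₁, t, ht, htx, hdesc⟩ :=
      hF₁ V G φ c H hW U S hS hU J x hx hcx hmax hJU hJ
    have hcommon : commonNbrs G U (fun _ => x) 0 = U := by simp [commonNbrs]
    obtain ⟨J₂, hJ₂, hcard₂, b, hb, htb⟩ := hF₂ V G φ c H hW U S hS hU (fun _ => x) S hS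
      (by rw [hcommon]; exact hU) J₁ (t D) (hJU.mono hJ₁) (by rw [hcommon]; exact ht D le_rfl)
      (by
        rw [hcommon]
        exact fun i hi j hj => (htx D le_rfl i hi).symm.trans (htx D le_rfl j hj)) hcard₁
    have hne₂ : J₂.Nonempty := Finset.card_pos.mp (by omega)
    set m := J₂.max' hne₂ with hm
    have hmJ : m ∈ J₂ := J₂.max'_mem hne₂
    have hsub : J₂.erase m ⊆ J₂ := Finset.erase_subset _ _
    obtain ⟨J₃, hJ₃, hcard₃, h₃⟩ := hF₃ V G φ c H U S hS hU (J₂.erase m) t (t D) b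
      (fun k hk j hj => ht k hk.le j (hJ₂ (hsub hj))) (fun j hj => ht D le_rfl j (hJ₂ (hsub hj)))
      (fun j hj => hb j (hsub hj)) (fun k hk => (hdesc k D hk le_rfl).mono (hsub.trans hJ₂))
      (htb.mono hsub) (by rw [Finset.card_erase_of_mem hmJ]; omega)
    have hJ₃₂ : J₃ ⊆ J₂ := hJ₃.trans hsub
    have hold : ∀ r ≤ D, Function.update t (D + 1) b r = t r := fun r hr =>
      Function.update_of_ne (by omega) _ _
    have hnew : Function.update t (D + 1) b (D + 1) = b := Function.update_self _ _ _
    refine ⟨J₃, hJ₃₂.trans (hJ₂.trans hJ₁), hcard₃, Function.update t (D + 1) b, ?_, ?_, ?_⟩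
    · intro r hr j hj
      rcases Nat.le_succ_iff.mp hr with hr | rfl
      · rw [hold r hr]; exact ht r hr j (hJ₂ (hJ₃₂ hj))
      · rw [hnew]; exact hb j (hJ₃₂ hj)
    · intro r hr j hj
      rcases Nat.le_succ_iff.mp hr with hr | rfl
      · rw [hold r hr]; exact htx r hr j (hJ₂ (hJ₃₂ hj))
      · rw [hnew]
        have hjm : j < m := lt_of_le_of_ne (J₂.le_max' j (hJ₃₂ hj))
          (Finset.ne_of_mem_erase (hJ₃ hj))
        exact (htx D le_rfl m (hJ₂ hmJ)).adj (htb j (hJ₃₂ hj) m hmJ hjm)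
          (ht D le_rfl m (hJ₂ hmJ)).1 (hb j (hJ₃₂ hj)).1
    · intro r r' hrr' hr'
      rcases Nat.le_succ_iff.mp hr' with hr' | rfl
      · rw [hold r (by omega), hold r' hr']
        exact (hdesc r r' hrr' hr').mono (hJ₃₂.trans hJ₂)
      · rw [hold r (by omega), hnew]
        rcases Nat.lt_succ_iff_lt_or_eq.mp hrr' with hr | rfl
        · exact h₃ r hr
        · exact htb.mono hJ₃₂

theorem exists_noWall (s : ℕ) :
    ∃ h, ∀ (V : Type) (G : SimpleGraph V) (φ c : V → ℕ), P5FreeColored G φ c →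
      NoWall G φ c s h := by
  induction s with
  | zero =>
    refine ⟨0, fun V G φ c _ S hS U hU J _ hwall => ?_⟩
    obtain ⟨⟨x, hx, -⟩, -⟩ := hwall
    have := Finset.card_pos.mpr ⟨_, hU x hx⟩
    omega
  | succ s ih =>
    obtain ⟨h, hh⟩ := ih
    obtain ⟨F, hF⟩ := exists_descending_family s h (s + 1) (s + 2)
    refine ⟨F, fun V G φ c H S hS U hU J hJ hwall => ?_⟩
    obtain ⟨⟨x, hx, hcx, hmax⟩, hJU⟩ := hwall
    obtain ⟨J', -, hcard, t, ht, -, hdesc⟩ :=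
      hF V G φ c H (hh V G φ c H) U S hS hU J x hx hcx hmax hJU hJ
    set e : Fin (s + 2) ↪o ℕ := J'.orderEmbOfCardLe hcard with he
    have heJ : ∀ k, e k ∈ J' := fun k => J'.orderEmbOfCardLe_mem _ k
    have hadj : ∀ k l : Fin (s + 2), k < l → G.Adj (t k (e k.rev)) (t l (e l.rev)) :=
      fun k l hkl => hdesc k l hkl (by omega) _ (heJ _) _ (heJ _)
        (e.lt_iff_lt.mpr (Fin.rev_lt_rev.mpr hkl))
    have hinj : Function.Injective fun k : Fin (s + 2) => φ (t k (e k.rev)) := by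
      intro k l hkl
      rcases lt_trichotomy k l with hlt | rfl | hlt
      · exact absurd hkl (H.proper _ _ (hadj k l hlt))
      · rfl
      · exact absurd hkl.symm (H.proper _ _ (hadj l k hlt))
    have := Finset.card_le_card_of_injOn (s := (Finset.univ : Finset (Fin (s + 2)))) (t := S)
      (fun k => φ (t k (e k.rev))) (fun k _ => hU _ (ht k (by omega) _ (heJ k.rev)).1) hinj.injOn
    rw [Finset.card_univ, Fintype.card_fin] at this
    omega

/-! ### The `b`-chromatic number bounds the chromatic number -/

theorem exists_coloring_le_bChrom {V : Type} [Fintype V] (G : SimpleGraph V) :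
    ∃ k ≤ bChrom G, G.Colorable k := by
  classical
  have hex : ∃ k, G.Colorable k := ⟨_, G.colorable_of_fintype⟩
  refine ⟨Nat.find hex, ?_, Nat.find_spec hex⟩
  obtain ⟨C⟩ := Nat.find_spec hex
  refine le_csSup ⟨Fintype.card V, ?_⟩ ⟨C, fun v w hvw => C.valid hvw, fun i => ?_⟩
  · rintro k ⟨C, -, hC⟩
    have hsurj : Function.Surjective C := fun i => (hC i).imp fun v hv => hv.1
    simpa using Fintype.card_le_of_surjective C hsurj
  · by_contra hcon
    push Not at hcon
    have : Nonempty (Fin (Nat.find hex)) := ⟨i⟩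
    choose! g hgi hg using hcon
    let C' : G.Coloring {j // j ≠ i} := Coloring.mk
      (fun v => if hv : C v = i then ⟨g v, hgi v hv⟩ else ⟨C v, hv⟩) (by
        intro v w hvw heq
        have hne := C.valid hvw
        have heq' := congrArg Subtype.val heq
        by_cases hv : C v = i <;> by_cases hw : C w = i <;> simp only [hv, hw, dite_true,
          dite_false] at heq'
        · exact hne (hv.trans hw.symm)
        · exact hg v hv w hvw heq'.symm
        · exact hg w hw v hvw.symm heq'
        · exact hne heq')
    have hlt : Fintype.card {j // j ≠ i} < Nat.find hex := by
      have := Fintype.card_subtype_lt (p := (· ≠ i)) (x := i) (by simp)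
      simpa using this
    exact Nat.find_min hex hlt C'.colorable

theorem no_p5_of_isEmpty {V : Type} {G : SimpleGraph V} (h : IsEmpty (pathGraph 5 ↪g G))
    (v₀ v₁ v₂ v₃ v₄ : V) (h01 : G.Adj v₀ v₁) (h12 : G.Adj v₁ v₂) (h23 : G.Adj v₂ v₃)
    (h34 : G.Adj v₃ v₄) (h02 : ¬ G.Adj v₀ v₂) (h03 : ¬ G.Adj v₀ v₃) (h04 : ¬ G.Adj v₀ v₄)
    (h13 : ¬ G.Adj v₁ v₃) (h14 : ¬ G.Adj v₁ v₄) (h24 : ¬ G.Adj v₂ v₄) : False := by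
  have hadj : ∀ i j : Fin 5,
      G.Adj (![v₀, v₁, v₂, v₃, v₄] i) (![v₀, v₁, v₂, v₃, v₄] j) ↔ (pathGraph 5).Adj i j := by
    intro i j
    rw [pathGraph_adj]
    fin_cases i <;> fin_cases j <;> simp [h01, h12, h23, h34, h02, h03, h04, h13, h14, h24,
      h01.symm, h12.symm, h23.symm, h34.symm, G.adj_comm v₂ v₀, G.adj_comm v₃ v₀,
      G.adj_comm v₄ v₀, G.adj_comm v₃ v₁, G.adj_comm v₄ v₁, G.adj_comm v₄ v₂]
  have htwin : ∀ i j : Fin 5, (∀ k : Fin 5, (i.val + 1 = k.val ∨ k.val + 1 = i.val) ↔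
      (j.val + 1 = k.val ∨ k.val + 1 = j.val)) → i = j := by decide
  refine h.false ⟨⟨![v₀, v₁, v₂, v₃, v₄], fun i j hij => htwin i j fun k => ?_⟩, hadj _ _⟩
  rw [← pathGraph_adj, ← pathGraph_adj, ← hadj, ← hadj, hij]

/-- The family of `P_5`-free graphs is `(Γ, b)`-bounded: there is `f : ℕ → ℕ` such that
every finite simple graph with no induced path on 5 vertices satisfies `Γ(G) ≤ f(b(G))`. -/
theorem stmt8 :
    ∃ f : ℕ → ℕ, ∀ (V : Type) [Fintype V] (G : SimpleGraph V),
      IsEmpty (SimpleGraph.pathGraph 5 ↪g G) → grundyNum G ≤ f (bChrom G) := by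
  choose f hf using exists_noWall
  refine ⟨f, fun V _ G hG => ?_⟩
  obtain ⟨k, hk, ⟨φ⟩⟩ := exists_coloring_le_bChrom G
  refine csSup_le' ?_
  rintro n ⟨C, hC, hsurj, hgrundy⟩
  by_contra hlt
  rw [not_le] at hlt
  have H : P5FreeColored G (fun v => (φ v).val) (fun v => (C v).val) :=
    ⟨no_p5_of_isEmpty hG, fun v w hvw h => φ.valid hvw (Fin.ext h),
      fun v w hvw h => hC v w hvw (Fin.ext h)⟩
  obtain ⟨x, hx⟩ := hsurj ⟨n - 1, by omega⟩
  refine hf (bChrom G) V G _ _ H (Finset.range k) (by simpa using hk) Set.univ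
    (fun v _ => by simp) (Finset.range n) (by simpa using hlt.le)
    ⟨⟨x, Set.mem_univ x, by simp, fun i hi => ?_⟩, fun v _ _ i hi hiv => ?_⟩
  · have := Finset.mem_range.mp hi
    simp only [hx]
    omega
  · obtain ⟨w, hvw, hw⟩ := hgrundy v ⟨i, Finset.mem_range.mp hi⟩ hiv
    exact ⟨w, Set.mem_univ w, hvw, by simp [hw]⟩
end

section
/- The family of trees is not (b,Γ)-bounded: for every integer p there exists a finite tree T with Γ(T) ≤ 4 and b(T) ≥ p. -/
open SimpleGraph

/-- The rooted tree of depth two in which the root and each of its `p` children have `p`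
children: `none` is the root, `some (i, none)` is its `i`-th child, and `some (i, some j)` is
the `j`-th leaf below that child. -/
abbrev DepthTwoVertex (p : ℕ) : Type := Option (Fin p × Option (Fin p))

namespace DepthTwoVertex

/-- The parent of a vertex other than the root. -/
def parent {p : ℕ} : Fin p × Option (Fin p) → DepthTwoVertex p
  | (_, none) => none
  | (i, some _) => some (i, none)

/-- The coloring witnessing that the b-chromatic number of the tree is at least `p + 1`. -/
def color {p : ℕ} : DepthTwoVertex p → Fin (p + 1)
  | none => 0
  | some (i, none) => i.succ
  | some (i, some j) => if j = i then 0 else j.succ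

end DepthTwoVertex

open DepthTwoVertex

/-- The graph joining each non-root vertex to its parent. -/
def depthTwoTree (p : ℕ) : SimpleGraph (DepthTwoVertex p) where
  Adj a b := (∃ x, a = some x ∧ b = parent x) ∨ (∃ x, b = some x ∧ a = parent x)
  symm := ⟨fun _ _ h => h.symm⟩
  loopless := ⟨by
    rintro a (⟨⟨i, _ | j⟩, rfl, h⟩ | ⟨⟨i, _ | j⟩, rfl, h⟩) <;> simp [parent] at h⟩

lemma depthTwoTree_adj_parent {p : ℕ} (x : Fin p × Option (Fin p)) :
    (depthTwoTree p).Adj (some x) (parent x) :=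
  Or.inl ⟨x, rfl, rfl⟩

lemma depthTwoTree_adj_leaf_iff {p : ℕ} {i j : Fin p} {w : DepthTwoVertex p} :
    (depthTwoTree p).Adj (some (i, some j)) w ↔ w = some (i, none) := by
  constructor
  · rintro (⟨x, hx, rfl⟩ | ⟨⟨k, _ | l⟩, rfl, h⟩)
    · cases hx
      rfl
    · simp [parent] at h
    · simp [parent] at h
  · rintro rfl
    exact depthTwoTree_adj_parent (i, some j)

lemma depthTwoTree_adj_child_iff {p : ℕ} {i : Fin p} {w : DepthTwoVertex p} :
    (depthTwoTree p).Adj (some (i, none)) w ↔ w = none ∨ ∃ j, w = some (i, some j) := by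
  constructor
  · rintro (⟨x, hx, rfl⟩ | ⟨⟨k, _ | l⟩, rfl, h⟩)
    · cases hx
      exact Or.inl rfl
    · simp [parent] at h
    · simp only [parent, Option.some.injEq, Prod.mk.injEq, and_true] at h
      exact Or.inr ⟨l, by rw [h]⟩
  · rintro (rfl | ⟨j, rfl⟩)
    · exact depthTwoTree_adj_parent (i, none)
    · exact (depthTwoTree_adj_parent (i, some j)).symm

lemma depthTwoTree_adj_root_iff {p : ℕ} {w : DepthTwoVertex p} :
    (depthTwoTree p).Adj none w ↔ ∃ i, w = some (i, none) := by
  constructor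
  · rintro (⟨x, hx, rfl⟩ | ⟨⟨k, _ | l⟩, rfl, h⟩)
    · cases hx
    · exact ⟨k, rfl⟩
    · simp [parent] at h
  · rintro ⟨i, rfl⟩
    exact (depthTwoTree_adj_parent (i, none)).symm

lemma depthTwoTree_reachable_root {p : ℕ} (v : DepthTwoVertex p) :
    (depthTwoTree p).Reachable v none := by
  match v with
  | none => exact .rfl
  | some (i, none) => exact (depthTwoTree_adj_parent (i, none)).reachable
  | some (i, some j) =>
    exact (depthTwoTree_adj_parent (i, some j)).reachable.trans
      (depthTwoTree_adj_parent (i, none)).reachable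

lemma depthTwoTree_connected (p : ℕ) : (depthTwoTree p).Connected where
  preconnected u v :=
    (depthTwoTree_reachable_root u).trans (depthTwoTree_reachable_root v).symm

lemma depthTwoTree_isTree (p : ℕ) : (depthTwoTree p).IsTree := by
  rw [isTree_iff_connected_and_card]
  refine ⟨depthTwoTree_connected p, le_antisymm ?_
    (depthTwoTree_connected p).card_vert_le_card_edgeSet_add_one⟩
  let f : Fin p × Option (Fin p) → (depthTwoTree p).edgeSet :=
    fun x => ⟨s(some x, parent x), depthTwoTree_adj_parent x⟩
  have hf : Function.Surjective f := by
    rintro ⟨e, he⟩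
    induction e with | _ a b
    have hab : (depthTwoTree p).Adj a b := he
    obtain ⟨x, rfl, rfl⟩ | ⟨x, rfl, rfl⟩ := hab
    · exact ⟨x, rfl⟩
    · exact ⟨x, Subtype.ext Sym2.eq_swap⟩
  rw [Finite.card_option]
  exact Nat.add_le_add_right (Nat.card_le_card_of_surjective f hf) 1

lemma depthTwoTree_isBColoring (p : ℕ) :
    IsBColoring (depthTwoTree p) (color : DepthTwoVertex p → Fin (p + 1)) := by
  have parent_ne (x : Fin p × Option (Fin p)) : color (some x) ≠ color (parent x) := by
    match x with
    | (i, none) => exact Fin.succ_ne_zero i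
    | (i, some j) =>
      by_cases h : j = i
      · simpa [color, parent, h] using (Fin.succ_ne_zero i).symm
      · simp [color, parent, h]
  refine ⟨?_, fun i => ?_⟩
  · rintro v w (⟨x, rfl, rfl⟩ | ⟨x, rfl, rfl⟩)
    · exact parent_ne x
    · exact (parent_ne x).symm
  · induction i using Fin.cases with
    | zero =>
      refine ⟨none, rfl, fun j hj => ?_⟩
      obtain ⟨j, rfl⟩ := Fin.exists_succ_eq.mpr hj
      exact ⟨some (j, none), depthTwoTree_adj_root_iff.mpr ⟨j, rfl⟩, rfl⟩
    | succ i =>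
      refine ⟨some (i, none), rfl, fun j hj => ?_⟩
      induction j using Fin.cases with
      | zero => exact ⟨none, depthTwoTree_adj_child_iff.mpr (.inl rfl), rfl⟩
      | succ j =>
        exact ⟨some (i, some j), depthTwoTree_adj_child_iff.mpr (.inr ⟨j, rfl⟩),
          if_neg fun h => hj (by rw [h])⟩

/-- In a Grundy coloring of the tree, leaves below a child of positive color have color zero. -/
lemma IsGrundyColoring.leaf_eq_zero {p k : ℕ} {C : DepthTwoVertex p → Fin k}
    (hC : IsGrundyColoring (depthTwoTree p) C) {i : Fin p} (j : Fin p)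
    (hi : 0 < (C (some (i, none))).val) : (C (some (i, some j))).val = 0 := by
  by_contra h
  obtain ⟨w, hw, hw0⟩ := hC.2.2 (some (i, some j)) ⟨0, by omega⟩
    (Fin.lt_def.mpr (Nat.pos_of_ne_zero h))
  rw [depthTwoTree_adj_leaf_iff] at hw
  subst hw
  simp [hw0] at hi

lemma IsGrundyColoring.child_le_two {p k : ℕ} {C : DepthTwoVertex p → Fin k}
    (hC : IsGrundyColoring (depthTwoTree p) C) (i : Fin p) :
    (C (some (i, none))).val ≤ 2 := by
  by_contra! h
  have root_eq (c : ℕ) (hc0 : 0 < c) (hc : c < (C (some (i, none))).val) :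
      (C none).val = c := by
    obtain ⟨w, hw, hwc⟩ := hC.2.2 (some (i, none)) ⟨c, by omega⟩ (Fin.lt_def.mpr hc)
    obtain rfl | ⟨j, rfl⟩ := depthTwoTree_adj_child_iff.mp hw
    · rw [hwc]
    · have := hC.leaf_eq_zero j (hc0.trans hc)
      simp only [hwc] at this
      omega
  have := root_eq 1 (by omega) (by omega)
  have := root_eq 2 (by omega) h
  omega

lemma IsGrundyColoring.le_three {p k : ℕ} {C : DepthTwoVertex p → Fin k}
    (hC : IsGrundyColoring (depthTwoTree p) C) (v : DepthTwoVertex p) : (C v).val ≤ 3 := by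
  match v with
  | none =>
    by_contra! h
    obtain ⟨w, hw, hw3⟩ := hC.2.2 none ⟨3, by omega⟩ (Fin.lt_def.mpr h)
    obtain ⟨i, rfl⟩ := depthTwoTree_adj_root_iff.mp hw
    have := hC.child_le_two i
    simp [hw3] at this
  | some (i, none) => exact (hC.child_le_two i).trans (by omega)
  | some (i, some j) =>
    by_contra! h
    have hi : ¬ 0 < (C (some (i, none))).val := fun hi => by
      have := hC.leaf_eq_zero j hi
      omega
    obtain ⟨w, hw, hw1⟩ := hC.2.2 (some (i, some j)) ⟨1, by omega⟩
      (Fin.lt_def.mpr (show 1 < _ by omega))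
    rw [depthTwoTree_adj_leaf_iff] at hw
    subst hw
    simp [hw1] at hi

lemma IsGrundyColoring.card_le_four {p k : ℕ} {C : DepthTwoVertex p → Fin k}
    (hC : IsGrundyColoring (depthTwoTree p) C) : k ≤ 4 := by
  by_contra! h
  obtain ⟨v, hv⟩ := hC.2.1 ⟨4, h⟩
  have := hC.le_three v
  simp [hv] at this

lemma IsGrundyColoring.comp_iso {V W : Type*} {G : SimpleGraph V} {H : SimpleGraph W} {k : ℕ}
    {C : W → Fin k} (hC : IsGrundyColoring H C) (e : G ≃g H) : IsGrundyColoring G (C ∘ e) := by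
  refine ⟨fun v w h => hC.1 _ _ (e.map_adj_iff.mpr h), hC.2.1.comp e.surjective, fun v i hi => ?_⟩
  obtain ⟨w, hw, hwi⟩ := hC.2.2 (e v) i hi
  obtain ⟨w, rfl⟩ := e.surjective w
  exact ⟨w, e.map_adj_iff.mp hw, hwi⟩

lemma IsBColoring.comp_iso {V W : Type*} {G : SimpleGraph V} {H : SimpleGraph W} {k : ℕ}
    {C : W → Fin k} (hC : IsBColoring H C) (e : G ≃g H) : IsBColoring G (C ∘ e) := by
  refine ⟨fun v w h => hC.1 _ _ (e.map_adj_iff.mpr h), fun i => ?_⟩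
  obtain ⟨v, hv, h⟩ := hC.2 i
  obtain ⟨v, rfl⟩ := e.surjective v
  refine ⟨v, hv, fun j hj => ?_⟩
  obtain ⟨w, hw, hwj⟩ := h j hj
  obtain ⟨w, rfl⟩ := e.surjective w
  exact ⟨w, e.map_adj_iff.mp hw, hwj⟩

lemma IsBColoring.le_bChrom {V : Type*} [Finite V] {G : SimpleGraph V} {k : ℕ}
    {C : V → Fin k} (hC : IsBColoring G C) : k ≤ bChrom G := by
  refine le_csSup ⟨Nat.card V, ?_⟩ ⟨C, hC⟩
  rintro l ⟨D, hD⟩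
  have hs : Function.Surjective D := fun i => (hD.2 i).imp fun _ h => h.1
  simpa using Nat.card_le_card_of_surjective D hs

/-- The family of trees is not `(b, Γ)`-bounded: for every `p` there is a finite tree `T`
with `Γ(T) ≤ 4` and `b(T) ≥ p`. -/
theorem stmt17 (p : ℕ) :
    ∃ (n : ℕ) (T : SimpleGraph (Fin n)),
      T.IsTree ∧ grundyNum T ≤ 4 ∧ p ≤ bChrom T := by
  let e := (depthTwoTree p).overFinIso (Fintype.card_eq_nat_card (α := DepthTwoVertex p))
  refine ⟨_, _, e.isTree_iff.mp (depthTwoTree_isTree p), ?_, ?_⟩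
  · refine csSup_le' ?_
    rintro k ⟨C, hC⟩
    exact (hC.comp_iso e).card_le_four
  · exact (Nat.le_succ p).trans ((depthTwoTree_isBColoring p).comp_iso e.symm).le_bChrom
end
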